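/- arXiv:0809.3091 — 9 statements merged into one kernel-verified Lean document; each statement's English description precedes it below -/
import Mathlib

section
/- Let r be payoff functions of an allocation game satisfying the symmetry condition r_n(ℓ) − r_n(ℓ − e_m) = r_m(ℓ) − r_m(ℓ − e_n) for all loads ℓ and all players n, m with ℓ_n = ℓ_m = 1. Let ℓ be a load vector with K players a(1), …, a(K) present (ℓ = Σ_{k=1}^K e_{a(k)}). Then the telescoping sum Σ_{k=0}^{K−1} r_{a(k+1)}(ℓ − Σ_{j=1}^{k} e_{a(j)}) is invariant under any permutation σ of {1, …, K}: it equals Σ_{k=0}^{K−1} r_{a(σ(k+1))}(ℓ − Σ_{j=1}^{k} e_{a(σ(j))}). -/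
/-- Telescoping sum along a list, removing players one at a time. -/
def teleSum {N : Type*} [DecidableEq N] (r : N → Finset N → ℝ) : List N → Finset N → ℝ
  | [], _ => 0
  | x :: l, L => r x L + teleSum r l (L.erase x)

theorem teleSum_perm {N : Type*} [DecidableEq N] (r : N → Finset N → ℝ)
    (hsym : ∀ (L : Finset N) (n m : N), n ∈ L → m ∈ L →
      r n L - r n (L.erase m) = r m L - r m (L.erase n))
    {l₁ l₂ : List N} (h : l₁.Perm l₂) :
    ∀ L : Finset N, l₁.Nodup → (∀ x ∈ l₁, x ∈ L) → teleSum r l₁ L = teleSum r l₂ L := by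
  induction h with
  | nil => intro L _ _; rfl
  | cons x h ih =>
    intro L hn hL
    simp only [teleSum]
    rw [ih]
    · exact (List.nodup_cons.1 hn).2
    · intro y hy
      refine Finset.mem_erase.2 ⟨?_, hL y (List.mem_cons_of_mem _ hy)⟩
      rintro rfl
      exact (List.nodup_cons.1 hn).1 hy
  | swap x y l =>
    intro L _ hL
    simp only [teleSum]
    rw [Finset.erase_right_comm]
    have := hsym L x y (hL x (by simp)) (hL y (by simp))
    linarith
  | trans h₁ h₂ ih₁ ih₂ =>
    intro L hn hL
    rw [ih₁ L hn hL, ih₂ L (h₁.nodup_iff.1 hn) (fun x hx => hL x (h₁.mem_iff.2 hx))]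

theorem sum_eq_teleSum {N : Type*} [DecidableEq N] (r : N → Finset N → ℝ) (K : ℕ) :
    ∀ (b : Fin K → N) (L : Finset N),
    ∑ k : Fin K, r (b k) (L \ Finset.image b (Finset.univ.filter (fun j => j < k)))
      = teleSum r (List.ofFn b) L := by
  induction K with
  | zero => intro b L; simp [teleSum]
  | succ K ih =>
    intro b L
    rw [Fin.sum_univ_succ, List.ofFn_succ, teleSum, ← ih]
    congr 1
    · simp
    · refine Finset.sum_congr rfl fun k _ => ?_
      congr 1
      ext x
      simp only [Finset.mem_sdiff, Finset.mem_image, Finset.mem_filter, Finset.mem_univ, true_and,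
        Finset.mem_erase, Fin.exists_fin_succ, Fin.succ_lt_succ_iff, Fin.succ_pos]
      grind

/-- if the payoffs `r` of an allocation game satisfy the symmetry condition
`r_n(ℓ) − r_n(ℓ − e_m) = r_m(ℓ) − r_m(ℓ − e_n)` (for players `n, m` present in the load `ℓ`),
and `ℓ` is a load consisting of the `K` distinct players `a 0, …, a (K-1)`, then the
telescoping sum `Σ_{k=0}^{K−1} r_{a(k+1)}(ℓ − Σ_{j=1}^{k} e_{a(j)})` (in 1-based notation)
is invariant under any permutation `σ` of the indices. -/
theorem telescoping_sum_perm_invariant {N : Type*} [DecidableEq N]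
    (r : N → Finset N → ℝ)
    (hsym : ∀ (L : Finset N) (n m : N), n ∈ L → m ∈ L →
      r n L - r n (L.erase m) = r m L - r m (L.erase n))
    (K : ℕ) (a : Fin K → N) (ha : Function.Injective a)
    (ℓ : Finset N) (hℓ : ℓ = Finset.image a Finset.univ)
    (σ : Equiv.Perm (Fin K)) :
    ∑ k : Fin K, r (a k) (ℓ \ Finset.image a (Finset.univ.filter (fun j => j < k)))
      = ∑ k : Fin K,
          r (a (σ k)) (ℓ \ Finset.image (fun j => a (σ j)) (Finset.univ.filter (fun j => j < k))) := by
  rw [sum_eq_teleSum r K a ℓ, sum_eq_teleSum r K (fun j => a (σ j)) ℓ]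
  refine teleSum_perm r hsym (Equiv.Perm.ofFn_comp_perm σ a).symm ℓ (List.nodup_ofFn.2 ha) ?_
  intro x hx
  rw [List.mem_ofFn] at hx
  obtain ⟨i, rfl⟩ := hx
  simp [hℓ]
end

section
/- Let r be payoff functions of an allocation game satisfying the symmetry condition r_n(ℓ) − r_n(ℓ − e_m) = r_m(ℓ) − r_m(ℓ − e_n) for all loads ℓ and all players n, m with ℓ_n = ℓ_m = 1. Define, for each load ℓ with K players a(1), …, a(K) present and each n with ℓ_n = 1, u_n(ℓ) = (1/K) Σ_{k=0}^{K−1} r_{a(k+1)}(ℓ − Σ_{j=1}^{k} e_{a(j)}). Then for every load ℓ and every n with ℓ_n = 1, Σ_{m : ℓ_m=1} u_m(ℓ) − Σ_{m≠n : ℓ_m=1} u_m(ℓ − e_n) = r_n(ℓ); i.e. r is the repercussion utility derived from the payoff u. -/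
/-- Sum of payoffs along successive removal of the players in a list. -/
def removalSum {N : Type*} [DecidableEq N] (r : N → Finset N → ℝ) : List N → ℝ
  | [] => 0
  | x :: l => r x (x :: l).toFinset + removalSum r l

theorem removalSum_perm {N : Type*} [DecidableEq N] (r : N → Finset N → ℝ)
    (hsym : ∀ (L : Finset N) (n m : N), n ∈ L → m ∈ L →
      r n L - r n (L.erase m) = r m L - r m (L.erase n))
    {l₁ l₂ : List N} (h : l₁.Perm l₂) (hd : l₁.Nodup) :
    removalSum r l₁ = removalSum r l₂ := by
  induction h with
  | nil => rfl
  | cons x h ih =>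
    have h1 := ih (List.nodup_cons.1 hd).2
    simp only [removalSum, h1, List.toFinset_cons, List.toFinset_eq_of_perm _ _ h]
  | swap x y l =>
    have h1 := hsym (insert y (insert x l.toFinset)) x y (by simp) (by simp)
    simp only [List.nodup_cons, List.mem_cons, not_or] at hd
    have e1 : (insert y (insert x l.toFinset)).erase y = insert x l.toFinset := by
      apply Finset.erase_insert; simp; tauto
    have e2 : (insert y (insert x l.toFinset)).erase x = insert y l.toFinset := by
      rw [Finset.insert_comm]
      apply Finset.erase_insert; simp; tauto
    rw [e1, e2] at h1
    simp only [removalSum, List.toFinset_cons]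
    rw [Finset.insert_comm x y]
    linarith
  | trans h₁ h₂ ih₁ ih₂ => rw [ih₁ hd, ih₂ (h₁.nodup_iff.1 hd)]

theorem removalSum_ofFn {N : Type*} [DecidableEq N] (r : N → Finset N → ℝ) :
    ∀ (k : ℕ) (f : Fin k → N), Function.Injective f →
    removalSum r (List.ofFn f) = ∑ i : Fin k, r (f i)
      (Finset.image f Finset.univ \ Finset.image f (Finset.univ.filter (fun j => j < i)))
  | 0, f, _ => by simp [removalSum]
  | k + 1, f, hf => by
    have ih := removalSum_ofFn r k (fun i => f i.succ)
      (fun i j h => Fin.succ_injective _ (hf h))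
    rw [List.ofFn_succ, Fin.sum_univ_succ, removalSum, ih]
    congr 1
    · congr 1
      ext x
      simp [List.mem_ofFn, Fin.exists_fin_succ, eq_comm]
    · apply Finset.sum_congr rfl
      intro i _
      congr 1
      rw [← Finset.image_sdiff _ _ hf, ← Finset.image_sdiff _ _
        (f := fun i : Fin k => f i.succ) (fun i j h => Fin.succ_injective _ (hf h))]
      ext x
      simp [Fin.exists_fin_succ]

/-- let `r` satisfy the symmetry condition
`r_n(ℓ) − r_n(ℓ − e_m) = r_m(ℓ) − r_m(ℓ − e_n)` for all loads `ℓ` and players `n, m`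
present in `ℓ`.  For each load `L`, let `a L : Fin L.card → N` be an enumeration of the
players present in `L`, and define for each `n ∈ L`
`u_n(L) = (1/K) Σ_{k=0}^{K−1} r_{a(k+1)}(L − Σ_{j=1}^{k} e_{a(j)})` with `K = L.card`.
Then for every load `ℓ` and `n ∈ ℓ`,
`Σ_{m : ℓ_m=1} u_m(ℓ) − Σ_{m≠n : ℓ_m=1} u_m(ℓ − e_n) = r_n(ℓ)`,
i.e. `r` is the repercussion utility derived from the payoff `u`. -/
theorem symmetric_payoff_is_repercussion {N : Type*} [DecidableEq N]
    (r : N → Finset N → ℝ)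
    (hsym : ∀ (L : Finset N) (n m : N), n ∈ L → m ∈ L →
      r n L - r n (L.erase m) = r m L - r m (L.erase n))
    (a : (L : Finset N) → Fin L.card → N)
    (hainj : ∀ L : Finset N, Function.Injective (a L))
    (haim : ∀ L : Finset N, Finset.image (a L) Finset.univ = L)
    (u : N → Finset N → ℝ)
    (hu : ∀ (L : Finset N), ∀ n ∈ L,
      u n L = (1 / (L.card : ℝ)) *
        ∑ k : Fin L.card,
          r (a L k) (L \ Finset.image (a L) (Finset.univ.filter (fun j => j < k))))
    (ℓ : Finset N) (n : N) (hn : n ∈ ℓ) :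
    (∑ m ∈ ℓ, u m ℓ) - ∑ m ∈ ℓ.erase n, u m (ℓ.erase n) = r n ℓ := by
  have key : ∀ L : Finset N, ∑ m ∈ L, u m L = removalSum r (List.ofFn (a L)) := by
    intro L
    rw [removalSum_ofFn r _ _ (hainj L), haim L, Finset.sum_congr rfl (hu L),
      Finset.sum_const, nsmul_eq_mul, ← mul_assoc]
    rcases L.eq_empty_or_nonempty with rfl | hL
    · have he : IsEmpty (Fin (∅ : Finset N).card) := by
        rw [Finset.card_empty]; infer_instance
      rw [Finset.univ_eq_empty, Finset.sum_empty, mul_zero]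
    · have : (L.card : ℝ) ≠ 0 := by exact_mod_cast hL.card_pos.ne'
      rw [mul_one_div_cancel this, one_mul]
  have hmem : ∀ (L : Finset N) x, x ∈ List.ofFn (a L) ↔ x ∈ L := by
    intro L x
    conv_rhs => rw [← haim L]
    simp [List.mem_ofFn]
  have hnd : ∀ L : Finset N, (List.ofFn (a L)).Nodup := fun L =>
    List.nodup_ofFn.2 (hainj L)
  have hp : (List.ofFn (a ℓ)).Perm (n :: List.ofFn (a (ℓ.erase n))) := by
    rw [List.perm_ext_iff_of_nodup (hnd _)
      (List.nodup_cons.2 ⟨by rw [hmem]; simp, hnd _⟩)]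
    intro x
    rw [List.mem_cons, hmem, hmem, Finset.mem_erase]
    by_cases hx : x = n
    · simp [hx, hn]
    · simp [hx]
  have hs : (n :: List.ofFn (a (ℓ.erase n))).toFinset = ℓ := by
    rw [← List.toFinset_eq_of_perm _ _ hp]
    ext x
    rw [List.mem_toFinset, hmem]
  rw [key, key, removalSum_perm r hsym hp (hnd _), removalSum, hs]
  ring
end

section
/- The function F(s) = Σ_{m∈𝒩} u_m(ℓ^{s_m}(s)) is an exact potential for the allocation game with repercussion utilities: if two pure action profiles s and s' differ only in the action of player n, then r_n(ℓ^{s_n}(s)) − r_n(ℓ^{s'_n}(s')) = F(s) − F(s'). -/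
/-- The load of action `i` under the pure action profile `s`. -/
def gload {N A : Type*} [Fintype N] [DecidableEq N] [DecidableEq A]
    (s : N → A) (i : A) : Finset N :=
  Finset.univ.filter (fun m => s m = i)

/-- The repercussion utility of player `n` under the profile `s`:
`r_n(ℓ^{s_n}(s)) = u_n(ℓ^{s_n}(s)) − Σ_{m≠n : s_m=s_n} (u_m(ℓ^{s_m}(s) − e_n) − u_m(ℓ^{s_m}(s)))`. -/
def repAlloc {N A : Type*} [Fintype N] [DecidableEq N] [DecidableEq A]
    (u : N → Finset N → ℝ) (s : N → A) (n : N) : ℝ :=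
  u n (gload s (s n)) -
    ∑ m ∈ (gload s (s n)).erase n,
      (u m ((gload s (s n)).erase n) - u m (gload s (s n)))

/-- The potential `F(s) = Σ_{m∈𝒩} u_m(ℓ^{s_m}(s))`. -/
def potAlloc {N A : Type*} [Fintype N] [DecidableEq N] [DecidableEq A]
    (u : N → Finset N → ℝ) (s : N → A) : ℝ :=
  ∑ m : N, u m (gload s (s m))

/-- The potential splits as the repercussion utility of `n` plus the total payoff of the
others when `n` is removed. -/
theorem potAlloc_eq_repAlloc_add {N A : Type*} [Fintype N] [DecidableEq N] [DecidableEq A]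
    (u : N → Finset N → ℝ) (s : N → A) (n : N) :
    potAlloc u s = repAlloc u s n +
      ∑ m ∈ Finset.univ.erase n, u m ((gload s (s m)).erase n) := by
  have h1 : ∑ m ∈ (gload s (s n)).erase n,
      (u m ((gload s (s n)).erase n) - u m (gload s (s n))) =
      ∑ m ∈ Finset.univ.erase n,
        (u m ((gload s (s m)).erase n) - u m (gload s (s m))) := by
    rw [← Finset.sum_subset (Finset.erase_subset_erase n (Finset.subset_univ (gload s (s n))))]
    · refine Finset.sum_congr rfl fun m hm => ?_
      have : s m = s n := by
        simpa [gload] using (Finset.mem_erase.mp hm).2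
      rw [this]
    · intro m hm hm'
      have hmn : m ≠ n := (Finset.mem_erase.mp hm).1
      have hne : s n ≠ s m := by
        intro h
        exact hm' (Finset.mem_erase.mpr ⟨hmn, by simp [gload, h]⟩)
      rw [Finset.erase_eq_of_notMem (by simpa [gload] using hne), sub_self]
  unfold repAlloc potAlloc
  rw [h1, Finset.sum_sub_distrib,
    ← Finset.add_sum_erase Finset.univ (fun m => u m (gload s (s m))) (Finset.mem_univ n)]
  ring

/-- `F(s) = Σ_m u_m(ℓ^{s_m}(s))` is an exact potential for the allocation
game with repercussion utilities: if the pure profiles `s` and `s'` (with actions in the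
allowed sets `ℐ_n`) differ only in the action of player `n`, then
`r_n(ℓ^{s_n}(s)) − r_n(ℓ^{s'_n}(s')) = F(s) − F(s')`. -/
theorem repercussion_exact_potential {N A : Type*}
    [Fintype N] [DecidableEq N] [DecidableEq A]
    (I : N → Finset A) (u : N → Finset N → ℝ)
    (s s' : N → A) (hs : ∀ m, s m ∈ I m) (hs' : ∀ m, s' m ∈ I m)
    (n : N) (hdiff : ∀ m, m ≠ n → s m = s' m) :
    repAlloc u s n - repAlloc u s' n = potAlloc u s - potAlloc u s' := by
  rw [potAlloc_eq_repAlloc_add u s n, potAlloc_eq_repAlloc_add u s' n]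
  have h : ∑ m ∈ Finset.univ.erase n, u m ((gload s (s m)).erase n) =
      ∑ m ∈ Finset.univ.erase n, u m ((gload s' (s' m)).erase n) := by
    refine Finset.sum_congr rfl fun m hm => ?_
    congr 1
    ext k
    by_cases hk : k = n
    · simp [hk]
    · simp [gload, hk, hdiff k hk, hdiff m (Finset.mem_erase.mp hm).1]
  rw [h]
  ring
end

section
/- The allocation game with repercussion utilities is a potential game in mixed strategies: for every player n and action i ∈ ℐ_n, the partial derivative of the potential satisfies ∂F/∂q_{n,i}(q) = f_{n,i}(q), where F(q) = Σ_{n∈𝒩} Σ_{i∈ℐ_n} q_{n,i} 𝔼[u_n(ℓ^i(S)) | S_n = i] and f_{n,i}(q) = 𝔼[r_n(ℓ^i(S)) | S_n = i], both expectations being the explicit multilinear polynomials Σ_{ℓ∈{0,1}^N, ℓ_n=1} (payoff at ℓ) · Π_{m≠n} q_{m,i}^{ℓ_m} (1 − q_{m,i})^{1−ℓ_m}. -/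
/-- The explicit multilinear polynomial giving the conditional expectation
`𝔼[g(ℓ^i(S)) | S_n = i] = Σ_{ℓ∈{0,1}^N, ℓ_n=1} g(ℓ) · Π_{m≠n} q_{m,i}^{ℓ_m}(1−q_{m,i})^{1−ℓ_m}`,
where loads `ℓ` with `ℓ_n = 1` are encoded as finsets `L` with `n ∈ L`. -/
def Eexp {N A : Type*} [Fintype N] [DecidableEq N]
    (g : Finset N → ℝ) (n : N) (i : A) (q : N → A → ℝ) : ℝ :=
  ∑ L ∈ Finset.univ.powerset.filter (fun L : Finset N => n ∈ L),
    g L * ∏ m ∈ Finset.univ.erase n, (if m ∈ L then q m i else 1 - q m i)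

/-- The repercussion utility as a function of the load:
`r_n(ℓ) = u_n(ℓ) − Σ_{m≠n : ℓ_m=1} (u_m(ℓ − e_n) − u_m(ℓ))`. -/
def repU {N : Type*} [DecidableEq N] (u : N → Finset N → ℝ) (n : N) (L : Finset N) : ℝ :=
  u n L - ∑ m ∈ L.erase n, (u m (L.erase n) - u m L)

/-- Total welfare of a load. -/
def welf {N : Type*} (u : N → Finset N → ℝ) (L : Finset N) : ℝ := ∑ m ∈ L, u m L

lemma repU_eq {N : Type*} [DecidableEq N] (u : N → Finset N → ℝ) (n : N) (L : Finset N)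
    (h : n ∈ L) : repU u n L = welf u L - welf u (L.erase n) := by
  unfold repU welf
  rw [Finset.sum_sub_distrib, ← Finset.add_sum_erase L (fun m => u m L) h]
  ring

/-- Expected welfare on action `j`. -/
def Gw {N A : Type*} [Fintype N] [DecidableEq N] (u : N → Finset N → ℝ) (j : A)
    (q : N → A → ℝ) : ℝ :=
  ∑ L : Finset N, welf u L * ∏ m, (if m ∈ L then q m j else 1 - q m j)

lemma mul_Eexp {N A : Type*} [Fintype N] [DecidableEq N] (g : Finset N → ℝ) (m : N) (j : A)
    (q : N → A → ℝ) :
    q m j * Eexp g m j q = ∑ L : Finset N, (if m ∈ L then g L else 0) *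
      ∏ k, (if k ∈ L then q k j else 1 - q k j) := by
  unfold Eexp
  rw [Finset.powerset_univ, Finset.mul_sum, Finset.sum_filter]
  refine Finset.sum_congr rfl fun L _ => ?_
  split_ifs with h
  · rw [← Finset.mul_prod_erase Finset.univ _ (Finset.mem_univ m), if_pos h]
    ring
  · simp

lemma sum_mul_Eexp {N A : Type*} [Fintype N] [DecidableEq N] (u : N → Finset N → ℝ) (j : A)
    (q : N → A → ℝ) : ∑ m, q m j * Eexp (u m) m j q = Gw u j q := by
  simp_rw [mul_Eexp]
  rw [Finset.sum_comm]
  unfold Gw welf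
  refine Finset.sum_congr rfl fun L _ => ?_
  rw [← Finset.sum_mul]
  simp

lemma Gw_affine {N A : Type*} [Fintype N] [DecidableEq N] (u : N → Finset N → ℝ) (n : N) (j : A)
    (q : N → A → ℝ) :
    Gw u j q = q n j * Eexp (repU u n) n j q + Eexp (fun L => welf u (L.erase n)) n j q := by
  unfold Gw Eexp
  rw [Finset.powerset_univ, Finset.mul_sum, ← Finset.sum_add_distrib,
    ← Finset.sum_filter_add_sum_filter_not Finset.univ (fun L : Finset N => n ∈ L)]
  have h2 : ∑ L ∈ Finset.univ.filter (fun L : Finset N => ¬ n ∈ L),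
      welf u L * ∏ m, (if m ∈ L then q m j else 1 - q m j) =
      ∑ L ∈ Finset.univ.filter (fun L : Finset N => n ∈ L),
      welf u (L.erase n) * ((1 - q n j) *
        ∏ m ∈ Finset.univ.erase n, (if m ∈ L then q m j else 1 - q m j)) := by
    refine Finset.sum_nbij' (fun L => insert n L) (fun L => L.erase n) ?_ ?_ ?_ ?_ ?_
    · intro L _; simp
    · intro L _; simp
    · intro L hL; exact Finset.erase_insert (by simpa using hL)
    · intro L hL; exact Finset.insert_erase (by simpa using hL)
    · intro L hL
      have hn : n ∉ L := by simpa using hL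
      rw [Finset.erase_insert hn, ← Finset.mul_prod_erase Finset.univ _ (Finset.mem_univ n),
        if_neg hn]
      congr 2
      refine Finset.prod_congr rfl fun m hm => ?_
      simp [Finset.ne_of_mem_erase hm]
  rw [h2, ← Finset.sum_add_distrib]
  refine Finset.sum_congr rfl fun L hL => ?_
  have hn : n ∈ L := by simpa using hL
  rw [repU_eq u n L hn, ← Finset.mul_prod_erase Finset.univ _ (Finset.mem_univ n), if_pos hn]
  ring

lemma Eexp_congr {N A : Type*} [Fintype N] [DecidableEq N] (g : Finset N → ℝ) (n : N) (j : A)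
    (q q' : N → A → ℝ) (h : ∀ m, m ≠ n → q m j = q' m j) : Eexp g n j q = Eexp g n j q' := by
  unfold Eexp
  refine Finset.sum_congr rfl fun L _ => ?_
  congr 1
  refine Finset.prod_congr rfl fun m hm => ?_
  rw [h m (Finset.ne_of_mem_erase hm)]

/-- the allocation game with repercussion utilities is a potential game in
mixed strategies: for every player `n` and action `i ∈ ℐ_n`, the partial derivative of
`F(q) = Σ_n Σ_{i∈ℐ_n} q_{n,i} 𝔼[u_n(ℓ^i(S)) | S_n = i]` with respect to `q_{n,i}`
equals `f_{n,i}(q) = 𝔼[r_n(ℓ^i(S)) | S_n = i]`. -/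
theorem potential_derivative_eq_expected_repercussion {N A : Type*}
    [Fintype N] [DecidableEq N] [Fintype A] [DecidableEq A]
    (u : N → Finset N → ℝ) (I : N → Finset A) (q : N → A → ℝ)
    (hq0 : ∀ m j, 0 ≤ q m j) (hq1 : ∀ m, ∑ j ∈ I m, q m j = 1)
    (hsupp : ∀ m j, j ∉ I m → q m j = 0)
    (n : N) (i : A) (hi : i ∈ I n) :
    HasDerivAt
      (fun t : ℝ =>
        ∑ m : N, ∑ j ∈ I m,
          Function.update q n (Function.update (q n) i t) m j *
            Eexp (u m) m j (Function.update q n (Function.update (q n) i t)))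
      (Eexp (repU u n) n i q) (q n i) := by
  have key : ∀ t : ℝ, (∑ m : N, ∑ j ∈ I m,
          Function.update q n (Function.update (q n) i t) m j *
            Eexp (u m) m j (Function.update q n (Function.update (q n) i t))) =
      t * Eexp (repU u n) n i q + (Eexp (fun L => welf u (L.erase n)) n i q +
        ∑ j ∈ Finset.univ.erase i, Gw u j q) := by
    intro t
    set q' := Function.update q n (Function.update (q n) i t) with hq'
    have e1 : ∀ m, m ≠ n → q' m = q m := fun m hm => by simp [hq', hm]
    have e2 : q' n i = t := by simp [hq']
    have e3 : ∀ m j, j ≠ i → q' m j = q m j := by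
      intro m j hj
      by_cases hm : m = n
      · subst hm; simp [hq', hj]
      · rw [e1 m hm]
    have hs : ∀ m j, j ∉ I m → q' m j = 0 := by
      intro m j hj
      by_cases hm : m = n
      · subst hm
        rw [e3 m j (fun h => hj (h ▸ hi)), hsupp m j hj]
      · rw [e1 m hm, hsupp m j hj]
    have h1 : ∀ m, ∑ j ∈ I m, q' m j * Eexp (u m) m j q' = ∑ j, q' m j * Eexp (u m) m j q' := by
      intro m
      refine Finset.sum_subset (Finset.subset_univ _) fun j _ hj => ?_
      rw [hs m j hj, zero_mul]
    simp_rw [h1]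
    rw [Finset.sum_comm]
    simp_rw [sum_mul_Eexp]
    rw [← Finset.add_sum_erase Finset.univ _ (Finset.mem_univ i), Gw_affine u n i q', e2,
      Eexp_congr _ n i q' q (fun m hm => by rw [e1 m hm]),
      Eexp_congr _ n i q' q (fun m hm => by rw [e1 m hm]), add_assoc]
    congr 2
    refine Finset.sum_congr rfl fun j hj => ?_
    unfold Gw
    simp_rw [fun m => e3 m j (Finset.ne_of_mem_erase hj)]
  rw [funext key]
  simpa using ((hasDerivAt_id (q n i)).mul_const (Eexp (repU u n) n i q)).add_const
    (Eexp (fun L => welf u (L.erase n)) n i q + ∑ j ∈ Finset.univ.erase i, Gw u j q)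
end

section
/- The expected one-step drift of the learning algorithm equals the replicator vector field: for every player n and action i, 𝔼[ r_n(ℓ^{S_n}(S)) (1_{S_n = i} − q_{n,i}) ] = q_{n,i} ( f_{n,i}(q) − f̄_n(q) ), where the expectation is over the random profile S = S(q). -/
open Finset in
theorem load_prob {N A : Type*} [Fintype N] [DecidableEq N] [Fintype A] [DecidableEq A]
    (q : N → A → ℝ) (hq : ∀ m, ∑ j, q m j = 1) (j : A) (L : Finset N) :
    ∑ s : N → A, (∏ m : N, q m (s m)) * (if gload s j = L then (1 : ℝ) else 0)
      = ∏ m : N, (if m ∈ L then q m j else 1 - q m j) := by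
  have h1 : ∀ m, (if m ∈ L then q m j else 1 - q m j)
      = ∑ a : A, q m a * (if (a = j ↔ m ∈ L) then (1 : ℝ) else 0) := by
    intro m
    by_cases hm : m ∈ L
    · simp [hm]
    · have h2 : ∀ a, q m a * (if (a = j ↔ m ∈ L) then (1 : ℝ) else 0)
          = q m a - (if a = j then q m a else 0) := by
        intro a
        by_cases h : a = j <;> simp [hm, h]
      rw [Finset.sum_congr rfl (fun a _ => h2 a), Finset.sum_sub_distrib, hq m]
      simp [hm]
  rw [Finset.prod_congr rfl (fun m _ => h1 m), Finset.prod_univ_sum, Fintype.piFinset_univ]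
  refine Finset.sum_congr rfl (fun s _ => ?_)
  rw [Finset.prod_mul_distrib]
  congr 1
  rw [Finset.prod_ite_zero]
  simp [gload, Finset.ext_iff]

theorem cond_exp {N A : Type*} [Fintype N] [DecidableEq N] [Fintype A] [DecidableEq A]
    (q : N → A → ℝ) (hq : ∀ m, ∑ j, q m j = 1) (g : Finset N → ℝ) (n : N) (j : A) :
    ∑ s : N → A, (∏ m : N, q m (s m)) * (if s n = j then g (gload s (s n)) else 0)
      = q n j * Eexp g n j q := by
  have h : ∀ L ∈ Finset.univ.powerset.filter (fun L : Finset N => n ∈ L),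
      q n j * (g L * ∏ m ∈ Finset.univ.erase n, (if m ∈ L then q m j else 1 - q m j))
      = ∑ s : N → A, (∏ m : N, q m (s m)) * (if gload s j = L then g L else 0) := by
    intro L hL
    have hn : n ∈ L := (Finset.mem_filter.1 hL).2
    have h3 := load_prob q hq j L
    rw [← Finset.mul_prod_erase _ _ (Finset.mem_univ n), if_pos hn] at h3
    rw [mul_left_comm, ← h3, Finset.mul_sum]
    refine Finset.sum_congr rfl (fun s _ => ?_)
    split_ifs <;> ring
  rw [Eexp, Finset.mul_sum, Finset.sum_congr rfl h, Finset.sum_comm]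
  refine Finset.sum_congr rfl (fun s _ => ?_)
  rw [← Finset.mul_sum]
  congr 1
  rw [Finset.sum_ite_eq]
  by_cases hs : s n = j
  · simp [hs, gload]
  · simp [hs, gload]

/-- the expected one-step drift of the learning algorithm equals the
replicator vector field: for every player `n` and action `i ∈ ℐ_n`,
`𝔼[ r_n(ℓ^{S_n}(S)) (1_{S_n = i} − q_{n,i}) ] = q_{n,i} ( f_{n,i}(q) − f̄_n(q) )`,
the expectation being over the random profile `S = S(q)` with independent components
and `ℙ(S_n = i) = q_{n,i}`, and `f̄_n(q) = Σ_{i∈ℐ_n} q_{n,i} f_{n,i}(q)`. -/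
theorem learning_drift_is_replicator {N A : Type*}
    [Fintype N] [DecidableEq N] [Fintype A] [DecidableEq A]
    (r : N → Finset N → ℝ) (I : N → Finset A) (q : N → A → ℝ)
    (hq0 : ∀ m j, 0 ≤ q m j) (hq1 : ∀ m, ∑ j ∈ I m, q m j = 1)
    (hsupp : ∀ m j, j ∉ I m → q m j = 0)
    (n : N) (i : A) (hi : i ∈ I n) :
    ∑ s : N → A, (∏ m : N, q m (s m)) *
        (r n (gload s (s n)) * ((if s n = i then (1 : ℝ) else 0) - q n i))
      = q n i * (Eexp (r n) n i q - ∑ j ∈ I n, q n j * Eexp (r n) n j q) := by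
  have hq : ∀ m, ∑ j, q m j = 1 := by
    intro m
    rw [← hq1 m]
    exact (Finset.sum_subset (Finset.subset_univ _) (fun j _ hj => hsupp m j hj)).symm
  have hbar : ∑ j ∈ I n, q n j * Eexp (r n) n j q
      = ∑ s : N → A, (∏ m : N, q m (s m)) * r n (gload s (s n)) := by
    rw [Finset.sum_subset (Finset.subset_univ (I n))
      (fun j _ hj => by rw [hsupp n j hj, zero_mul]),
      Finset.sum_congr rfl (fun j _ => (cond_exp q hq (r n) n j).symm), Finset.sum_comm]
    refine Finset.sum_congr rfl (fun s _ => ?_)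
    rw [← Finset.mul_sum]
    simp
  rw [mul_sub, hbar, ← cond_exp q hq (r n) n i, Finset.mul_sum, ← Finset.sum_sub_distrib]
  refine Finset.sum_congr rfl (fun s _ => ?_)
  split_ifs <;> ring
end

section
/- If q is a stationary point of the replicator dynamics (i.e. for every n and i, q_{n,i} = 0 or f_{n,i}(q) = f̄_n(q)), then under one step of the learning algorithm the strategy process is a martingale: 𝔼[ q_{n,i}(t+1) | q(t) = q ] = q_{n,i} for every player n and action i. -/
theorem sum_profile_prod {N A : Type*} [Fintype N] [DecidableEq N] [Fintype A]
    (h : N → A → ℝ) : ∑ s : N → A, ∏ m : N, h m (s m) = ∏ m : N, ∑ a : A, h m a := by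
  rw [Finset.prod_univ_sum, Fintype.piFinset_univ]

theorem sum_profile_cond {N A : Type*} [Fintype N] [DecidableEq N] [Fintype A] [DecidableEq A]
    (g : Finset N → ℝ) (q : N → A → ℝ) (hq : ∀ m, ∑ a, q m a = 1) (n : N) (j : A) :
    ∑ s : N → A, (if s n = j then (∏ m : N, q m (s m)) * g (gload s j) else 0)
      = q n j * Eexp g n j q := by
  have key : ∀ L : Finset N, n ∈ L →
      ∑ s : N → A, (if gload s j = L then ∏ m : N, q m (s m) else 0)
        = q n j * ∏ m ∈ Finset.univ.erase n, (if m ∈ L then q m j else 1 - q m j) := by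
    intro L hL
    have h1 : ∀ s : N → A, (if gload s j = L then ∏ m : N, q m (s m) else 0)
        = ∏ m : N, (if (s m = j ↔ m ∈ L) then q m (s m) else 0) := by
      intro s
      by_cases hs : gload s j = L
      · rw [if_pos hs]
        refine Finset.prod_congr rfl fun m _ => ?_
        rw [if_pos]
        rw [← hs]
        simp [gload]
      · rw [if_neg hs]
        have : ∃ m, ¬ (s m = j ↔ m ∈ L) := by
          by_contra hc
          push Not at hc
          apply hs
          ext m
          simp only [gload, Finset.mem_filter, Finset.mem_univ, true_and]
          exact hc m
        obtain ⟨m, hm⟩ := this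
        exact (Finset.prod_eq_zero (Finset.mem_univ m) (if_neg hm)).symm
    rw [Finset.sum_congr rfl fun s _ => h1 s,
      sum_profile_prod (fun m a => if (a = j ↔ m ∈ L) then q m a else 0)]
    have h2 : ∀ m, ∑ a, (if (a = j ↔ m ∈ L) then q m a else 0)
        = if m ∈ L then q m j else 1 - q m j := by
      intro m
      by_cases hm : m ∈ L
      · simp [hm]
      · simp only [hm, iff_false, if_false]
        rw [← hq m, eq_sub_iff_add_eq]
        have : q m j = ∑ a, if a = j then q m a else 0 := by simp
        rw [this, ← Finset.sum_add_distrib]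
        refine Finset.sum_congr rfl fun a _ => ?_
        by_cases ha : a = j <;> simp [ha]
    rw [Finset.prod_congr rfl fun m _ => h2 m,
      ← Finset.mul_prod_erase Finset.univ _ (Finset.mem_univ n), if_pos hL]
  unfold Eexp
  rw [Finset.mul_sum]
  have h3 : ∀ L ∈ Finset.univ.powerset.filter (fun L : Finset N => n ∈ L),
      q n j * (g L * ∏ m ∈ Finset.univ.erase n, (if m ∈ L then q m j else 1 - q m j))
      = ∑ s : N → A, (if gload s j = L then (∏ m : N, q m (s m)) * g L else 0) := by
    intro L hL
    rw [mul_left_comm, ← key L (Finset.mem_filter.mp hL).2, Finset.mul_sum]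
    refine Finset.sum_congr rfl fun s _ => ?_
    split_ifs <;> ring
  rw [Finset.sum_congr rfl h3, Finset.sum_comm]
  refine Finset.sum_congr rfl fun s _ => ?_
  rw [Finset.sum_ite_eq]
  simp [gload]

/-- if `q` is a stationary point of the replicator dynamics (for every `n`
and `i`, `q_{n,i} = 0` or `f_{n,i}(q) = f̄_n(q)`), then one step of the learning
algorithm `q_{n,i}(t+1) = q_{n,i}(t) + ε r_n(ℓ^{S_n}(S)) (1_{S_n=i} − q_{n,i}(t))` is a
martingale: `𝔼[ q_{n,i}(t+1) | q(t) = q ] = q_{n,i}`, the expectation being over the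
random profile `S = S(q)`. -/
theorem stationary_point_learning_martingale {N A : Type*}
    [Fintype N] [DecidableEq N] [Fintype A] [DecidableEq A]
    (r : N → Finset N → ℝ) (I : N → Finset A) (q : N → A → ℝ)
    (hq0 : ∀ m j, 0 ≤ q m j) (hq1 : ∀ m, ∑ j ∈ I m, q m j = 1)
    (hsupp : ∀ m j, j ∉ I m → q m j = 0)
    (ε : ℝ) (hε : 0 < ε)
    (hstat : ∀ (m : N), ∀ j ∈ I m,
      q m j = 0 ∨ Eexp (r m) m j q = ∑ l ∈ I m, q m l * Eexp (r m) m l q)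
    (n : N) (i : A) (hi : i ∈ I n) :
    ∑ s : N → A, (∏ m : N, q m (s m)) *
        (q n i + ε * r n (gload s (s n)) * ((if s n = i then (1 : ℝ) else 0) - q n i))
      = q n i := by
  have hq : ∀ m, ∑ a, q m a = 1 := by
    intro m
    rw [← hq1 m]
    exact (Finset.sum_subset (Finset.subset_univ _) fun a _ ha => hsupp m a ha).symm
  have hT : ∑ s : N → A, ∏ m : N, q m (s m) = 1 := by
    rw [sum_profile_prod]
    simp [hq]
  have hR : ∑ s : N → A, (∏ m : N, q m (s m)) * r n (gload s (s n))
      = ∑ l ∈ I n, q n l * Eexp (r n) n l q := by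
    rw [Finset.sum_subset (Finset.subset_univ (I n))
      (fun a _ ha => by rw [hsupp n a ha, zero_mul])]
    rw [← Finset.sum_congr rfl fun l _ => sum_profile_cond (r n) q hq n l, Finset.sum_comm]
    refine Finset.sum_congr rfl fun s _ => ?_
    rw [Finset.sum_ite_eq]
    simp
  have hI := sum_profile_cond (r n) q hq n i
  have hsplit : ∀ s : N → A, (∏ m : N, q m (s m)) *
        (q n i + ε * r n (gload s (s n)) * ((if s n = i then (1 : ℝ) else 0) - q n i))
      = q n i * (∏ m : N, q m (s m))
        + ε * (if s n = i then (∏ m : N, q m (s m)) * r n (gload s i) else 0)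
        - ε * q n i * ((∏ m : N, q m (s m)) * r n (gload s (s n))) := by
    intro s
    by_cases h : s n = i
    · simp only [h, if_true]; ring
    · simp only [h, if_false]; ring
  rw [Finset.sum_congr rfl fun s _ => hsplit s, Finset.sum_sub_distrib, Finset.sum_add_distrib,
    ← Finset.mul_sum, ← Finset.mul_sum, ← Finset.mul_sum, hT, hI, hR]
  rcases hstat n i hi with h | h
  · rw [h]; ring
  · rw [← h]; ring
end

section
/- Assume all payoffs are strictly positive, r_n(ℓ) > 0 for every player n and load ℓ, and ε > 0. If a mixed profile q is a fixed point of the learning recursion for every realization in the support of S(q) — that is, for every pure profile s with Π_n q_{n,s_n} > 0 and every n, i one has r_n(ℓ^{s_n}(s))(1_{s_n=i} − q_{n,i}) = 0 — then q is a pure point: q_{n,i} ∈ {0, 1} for all n and i. -/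
/-- assume all payoffs are strictly positive and `ε > 0`.  If the mixed
profile `q` is a fixed point of the learning recursion for every realization in the
support of `S(q)` — i.e. for every pure profile `s` with `Π_n q_{n,s_n} > 0` and every
`n, i` one has `r_n(ℓ^{s_n}(s))(1_{s_n=i} − q_{n,i}) = 0` — then `q` is a pure point:
`q_{n,i} ∈ {0, 1}` for all `n` and `i`. -/
theorem fixed_point_of_learning_is_pure {N A : Type*}
    [Fintype N] [DecidableEq N] [Fintype A] [DecidableEq A]
    (r : N → Finset N → ℝ) (I : N → Finset A) (q : N → A → ℝ)
    (hq0 : ∀ m j, 0 ≤ q m j) (hq1 : ∀ m, ∑ j ∈ I m, q m j = 1)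
    (hsupp : ∀ m j, j ∉ I m → q m j = 0)
    (hrpos : ∀ (m : N) (L : Finset N), 0 < r m L)
    (ε : ℝ) (hε : 0 < ε)
    (hfix : ∀ s : N → A, 0 < ∏ m : N, q m (s m) →
      ∀ (m : N) (j : A),
        r m (gload s (s m)) * ((if s m = j then (1 : ℝ) else 0) - q m j) = 0) :
    ∀ (m : N) (j : A), q m j = 0 ∨ q m j = 1 := by
  have hex : ∀ m, ∃ j, 0 < q m j := by
    intro m
    by_contra! h
    have h0 : ∑ j ∈ I m, q m j ≤ 0 := Finset.sum_nonpos (fun j _ => h j)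
    rw [hq1 m] at h0
    linarith
  choose s hs using hex
  intro m j
  have h := hfix s (Finset.prod_pos (fun k _ => hs k)) m j
  rcases mul_eq_zero.mp h with h | h
  · exact absurd h (hrpos m _).ne'
  · split_ifs at h
    · right; linarith
    · left; linarith
end

section
/- Let k_{00}, k_{01}, k_{10}, k_{11} be reals with k_{00} > k_{01}, k_{00} > k_{10}, k_{11} > k_{01}, k_{11} > k_{10}, and k_{11} > k_{00}, and set K = k_{11} + k_{00} − k_{01} − k_{10}. Define L(x,y) = −x(1−x)(k_{01} − k_{00} + K y) − y(1−y)(k_{10} − k_{00} + K x). Then L(x,y) < 0 for every (x,y) with 0 < x < 1, 0 < y < 1 and x + y ≥ 1. In particular, on the segment x + y = 1, L(x, 1−x) = −x(1−x)(k_{11} − k_{00}) < 0. -/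
/-- let `k₀₀, k₀₁, k₁₀, k₁₁` be reals with `k₀₀ > k₀₁`, `k₀₀ > k₁₀`,
`k₁₁ > k₀₁`, `k₁₁ > k₁₀` and `k₁₁ > k₀₀`, and set `K = k₁₁ + k₀₀ − k₀₁ − k₁₀`.  Define
`L(x,y) = −x(1−x)(k₀₁ − k₀₀ + K y) − y(1−y)(k₁₀ − k₀₀ + K x)`.  Then `L(x,y) < 0` for
every `(x,y)` with `0 < x < 1`, `0 < y < 1` and `x + y ≥ 1`; in particular, on the
segment `x + y = 1`, `L(x, 1−x) = −x(1−x)(k₁₁ − k₀₀) < 0`. -/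
theorem lyapunov_derivative_negative_on_region (k00 k01 k10 k11 : ℝ)
    (h1 : k00 > k01) (h2 : k00 > k10) (h3 : k11 > k01) (h4 : k11 > k10)
    (h5 : k11 > k00) :
    (∀ x y : ℝ, 0 < x → x < 1 → 0 < y → y < 1 → x + y ≥ 1 →
        -(x * (1 - x) * (k01 - k00 + (k11 + k00 - k01 - k10) * y))
          - y * (1 - y) * (k10 - k00 + (k11 + k00 - k01 - k10) * x) < 0) ∧
      (∀ x : ℝ, 0 < x → x < 1 →
        -(x * (1 - x) * (k01 - k00 + (k11 + k00 - k01 - k10) * (1 - x)))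
            - (1 - x) * (1 - (1 - x)) * (k10 - k00 + (k11 + k00 - k01 - k10) * x)
          = -(x * (1 - x) * (k11 - k00)) ∧
        -(x * (1 - x) * (k11 - k00)) < 0) := by
  refine ⟨?_, ?_⟩
  · intro x y hx hx1 hy hy1 hxy
    have hd : 0 < (k11 - k00) * (x * y * (2 - x - y)) :=
      mul_pos (by linarith) (mul_pos (mul_pos hx hy) (by linarith))
    have ha : 0 ≤ (k00 - k01) * (x * (1 - y) * (x + y - 1)) :=
      mul_nonneg (by linarith)
        (mul_nonneg (mul_nonneg hx.le (by linarith)) (by linarith))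
    have hb : 0 ≤ (k00 - k10) * (y * (1 - x) * (x + y - 1)) :=
      mul_nonneg (by linarith)
        (mul_nonneg (mul_nonneg hy.le (by linarith)) (by linarith))
    linarith
  · intro x hx hx1
    refine ⟨by ring, ?_⟩
    have : 0 < x * (1 - x) * (k11 - k00) :=
      mul_pos (mul_pos hx (by linarith)) (by linarith)
    linarith
end

section
/- In a two-player two-action allocation game with repercussion utilities whose associated planar replicator dynamics is dx/dt = x(1−x)(k_{01} − k_{00} + K y), dy/dt = y(1−y)(k_{10} − k_{00} + K x) with K = k_{11} + k_{00} − k_{01} − k_{10}, if the potential has two local maxima located at (0,0) and (1,1) (k_{00} > k_{01}, k_{00} > k_{10}, k_{11} > k_{01}, k_{11} > k_{10}) with global maximum at (1,1) (k_{11} > k_{00}), then the trajectory starting at the uniform initial point (x(0), y(0)) = (1/2, 1/2) converges to the global maximum (1,1) as t → ∞; more precisely, V(x,y) = 2 − x − y is strictly decreasing along any trajectory in E = { (x,y) : x + y > 1, 0 < x, y < 1 }, and every trajectory started in E converges to (1,1). -/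
/-- A solution of the linear equation `u' = u g` with positive initial value stays positive. -/
lemma pos_of_linear_ode (u g : ℝ → ℝ) (hg : Continuous g)
    (hu : ∀ t, HasDerivAt u (u t * g t) t) (h0 : 0 < u 0) (t : ℝ) : 0 < u t := by
  have hI : ∀ t, HasDerivAt (fun t => ∫ s in (0:ℝ)..t, g s) (g t) t := fun t =>
    intervalIntegral.integral_hasDerivAt_right (hg.intervalIntegrable _ _)
      hg.stronglyMeasurable.stronglyMeasurableAtFilter hg.continuousAt
  have hd : ∀ t, HasDerivAt (fun t => u t * Real.exp (-∫ s in (0:ℝ)..t, g s)) 0 t := by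
    intro t
    have hn : HasDerivAt (fun t => -∫ s in (0:ℝ)..t, g s) (-g t) t := (hI t).neg
    exact ((hu t).mul hn.exp).congr_deriv (by ring)
  have hc := is_const_of_deriv_eq_zero (fun t => (hd t).differentiableAt)
    (fun t => (hd t).deriv) t 0
  simp only [intervalIntegral.integral_same, neg_zero, Real.exp_zero, mul_one] at hc
  have h : 0 < u t * Real.exp (-∫ s in (0:ℝ)..t, g s) := by rw [hc]; exact h0
  exact (pos_iff_pos_of_mul_pos h).2 (Real.exp_pos _)

/-- The case of the speed estimate in which the first factor is nonpositive. -/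
lemma speed_pos_aux (a b D x y : ℝ) (ha : 0 < a) (hb : 0 < b) (hD : 0 < D)
    (hx0 : 0 < x) (hx1 : x ≤ 1) (hy0 : 0 < y) (hs : 1 ≤ x + y)
    (hf : -a + (a + b + D) * y ≤ 0) :
    0 < x * (1 - x) * (-a + (a + b + D) * y) + y * (1 - y) * (-b + (a + b + D) * x) := by
  have e1 : x * (1 - x) * (a - (a + b + D) * y) ≤ x * y * (a - (a + b + D) * y) := by
    apply mul_le_mul_of_nonneg_right _ (by linarith)
    nlinarith
  have e2 : x * (a - (a + b + D) * y) < (1 - y) * (-b + (a + b + D) * x) := by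
    nlinarith [mul_pos hD hx0, mul_nonneg hb.le (by linarith : 0 ≤ x + y - 1)]
  nlinarith [mul_lt_mul_of_pos_left e2 hy0]

/-- Positivity of `x' + y'` on the relevant region. -/
lemma speed_pos (a b D x y : ℝ) (ha : 0 < a) (hb : 0 < b) (hD : 0 < D)
    (hx0 : 0 < x) (hx1 : x ≤ 1) (hy0 : 0 < y) (hy1 : y ≤ 1) (hs : 1 ≤ x + y)
    (hs2 : x + y < 2) :
    0 < x * (1 - x) * (-a + (a + b + D) * y) + y * (1 - y) * (-b + (a + b + D) * x) := by
  rcases le_or_gt (-a + (a + b + D) * y) 0 with hf | hf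
  · exact speed_pos_aux a b D x y ha hb hD hx0 hx1 hy0 hs hf
  rcases le_or_gt (-b + (a + b + D) * x) 0 with hg | hg
  · have := speed_pos_aux b a D y x hb ha hD hy0 hy1 hx0 (by linarith) (by linarith)
    nlinarith
  rcases lt_or_ge x 1 with h | h
  · have h3 := mul_pos (mul_pos hx0 (by linarith : 0 < 1 - x)) hf
    have h4 := mul_nonneg (mul_nonneg hy0.le (by linarith : 0 ≤ 1 - y)) hg.le
    linarith
  · have h3 := mul_nonneg (mul_nonneg hx0.le (by linarith : 0 ≤ 1 - x)) hf.le
    have h4 := mul_pos (mul_pos hy0 (by linarith : 0 < 1 - y)) hg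
    linarith


/-- consider the planar replicator dynamics
`dx/dt = x(1−x)(k₀₁ − k₀₀ + K y)`, `dy/dt = y(1−y)(k₁₀ − k₀₀ + K x)` with
`K = k₁₁ + k₀₀ − k₀₁ − k₁₀`, of a two-player two-action allocation game with
repercussion utilities whose potential has two local maxima at `(0,0)` and `(1,1)`
(`k₀₀ > k₀₁`, `k₀₀ > k₁₀`, `k₁₁ > k₀₁`, `k₁₁ > k₁₀`) and global maximum at `(1,1)`
(`k₁₁ > k₀₀`).  Then along any trajectory started either in
`E = {(x,y) : x + y > 1, 0 < x, y < 1}` or at the uniform initial point `(1/2, 1/2)`,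
the function `V(x,y) = 2 − x − y` is strictly decreasing, and the trajectory converges
to the global maximum `(1,1)` as `t → ∞`. -/
theorem replicator_from_uniform_converges_to_global_max (k00 k01 k10 k11 : ℝ)
    (h1 : k00 > k01) (h2 : k00 > k10) (h3 : k11 > k01) (h4 : k11 > k10)
    (h5 : k11 > k00)
    (x y : ℝ → ℝ)
    (hx : ∀ t : ℝ, HasDerivAt x
      (x t * (1 - x t) * (k01 - k00 + (k11 + k00 - k01 - k10) * y t)) t)
    (hy : ∀ t : ℝ, HasDerivAt y
      (y t * (1 - y t) * (k10 - k00 + (k11 + k00 - k01 - k10) * x t)) t)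
    (hinit : (x 0 + y 0 > 1 ∧ 0 < x 0 ∧ x 0 < 1 ∧ 0 < y 0 ∧ y 0 < 1) ∨
      (x 0 = 1 / 2 ∧ y 0 = 1 / 2)) :
    (∀ s t : ℝ, 0 ≤ s → s < t → 2 - x t - y t < 2 - x s - y s) ∧
      Filter.Tendsto (fun t => (x t, y t)) Filter.atTop (nhds (1, 1)) := by

  have hxc : Continuous x := continuous_iff_continuousAt.2 fun t => (hx t).continuousAt
  have hyc : Continuous y := continuous_iff_continuousAt.2 fun t => (hy t).continuousAt
  have hini : 1 ≤ x 0 + y 0 ∧ 0 < x 0 ∧ x 0 < 1 ∧ 0 < y 0 ∧ y 0 < 1 := by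
    rcases hinit with ⟨h, h'⟩ | ⟨h, h'⟩
    · exact ⟨h.le, h'⟩
    · rw [h, h']; norm_num
  obtain ⟨i0, ix0, ix1, iy0, iy1⟩ := hini
  have px : ∀ t, 0 < x t := pos_of_linear_ode x
    (fun t => (1 - x t) * (k01 - k00 + (k11 + k00 - k01 - k10) * y t)) (by fun_prop)
    (fun t => by convert hx t using 1; ring) ix0
  have py : ∀ t, 0 < y t := pos_of_linear_ode y
    (fun t => (1 - y t) * (k10 - k00 + (k11 + k00 - k01 - k10) * x t)) (by fun_prop)
    (fun t => by convert hy t using 1; ring) iy0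
  have qx : ∀ t, 0 < 1 - x t := pos_of_linear_ode (fun t => 1 - x t)
    (fun t => - (x t * (k01 - k00 + (k11 + k00 - k01 - k10) * y t))) (by fun_prop)
    (fun t => ((hx t).const_sub 1).congr_deriv (by ring)) (by linarith)
  have qy : ∀ t, 0 < 1 - y t := pos_of_linear_ode (fun t => 1 - y t)
    (fun t => - (y t * (k10 - k00 + (k11 + k00 - k01 - k10) * x t))) (by fun_prop)
    (fun t => ((hy t).const_sub 1).congr_deriv (by ring)) (by linarith)
  have hG : ∀ u v : ℝ, 0 < u → u ≤ 1 → 0 < v → v ≤ 1 → 1 ≤ u + v → u + v < 2 →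
      0 < u * (1 - u) * (k01 - k00 + (k11 + k00 - k01 - k10) * v)
        + v * (1 - v) * (k10 - k00 + (k11 + k00 - k01 - k10) * u) := by
    intro u v hu0 hu1 hv0 hv1 hs hs2
    have := speed_pos (k00 - k01) (k00 - k10) (k11 - k00) u v (by linarith) (by linarith)
      (by linarith) hu0 hu1 hv0 hv1 hs hs2
    convert this using 1
    ring
  have hS : ∀ t, HasDerivAt (fun t => x t + y t)
      (x t * (1 - x t) * (k01 - k00 + (k11 + k00 - k01 - k10) * y t)
        + y t * (1 - y t) * (k10 - k00 + (k11 + k00 - k01 - k10) * x t)) t :=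
    fun t => (hx t).add (hy t)
  have hSc : Continuous (fun t => x t + y t) := hxc.add hyc
  have hge : ∀ t, 0 ≤ t → 1 ≤ x t + y t := by
    intro T hT
    refine image_le_of_deriv_right_lt_deriv_boundary' (f := fun _ => (1:ℝ)) (f' := fun _ => 0)
      (a := 0) (b := T) continuousOn_const (fun t _ => hasDerivWithinAt_const _ _ _)
      (B := fun t => x t + y t) i0 hSc.continuousOn (fun t _ => (hS t).hasDerivWithinAt)
      ?_ ⟨hT, le_rfl⟩
    intro t _ he
    have he' : 1 = x t + y t := he
    exact hG _ _ (px t) (by linarith [qx t]) (py t) (by linarith [qy t]) he'.le (by linarith)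
  have hpos : ∀ t, 0 ≤ t → 0 < x t * (1 - x t) * (k01 - k00 + (k11 + k00 - k01 - k10) * y t)
        + y t * (1 - y t) * (k10 - k00 + (k11 + k00 - k01 - k10) * x t) := fun t ht =>
    hG _ _ (px t) (by linarith [qx t]) (py t) (by linarith [qy t]) (hge t ht)
      (by linarith [qx t, qy t])
  have hmono : StrictMonoOn (fun t => x t + y t) (Set.Ici 0) := by
    apply strictMonoOn_of_deriv_pos (convex_Ici 0) hSc.continuousOn
    intro t ht
    rw [interior_Ici] at ht
    rw [(hS t).deriv]
    exact hpos t (le_of_lt ht)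
  have hdec : ∀ s t : ℝ, 0 ≤ s → s < t → x s + y s < x t + y t := fun s t hs hst =>
    hmono hs (hs.trans hst.le) hst
  refine ⟨fun s t hs hst => by linarith [hdec s t hs hst], ?_⟩
  have key : ∀ ε > 0, ∃ T, 0 ≤ T ∧ 2 - ε < x T + y T := by
    intro ε hε
    by_contra! hcon
    have hs0 : 1 < x 1 + y 1 := lt_of_le_of_lt i0 (hdec 0 1 le_rfl one_pos)
    let C : Set (ℝ × ℝ) := (Set.Icc 0 1 ×ˢ Set.Icc 0 1) ∩
      {p | x 1 + y 1 ≤ p.1 + p.2 ∧ p.1 + p.2 ≤ 2 - ε}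
    have hC : IsCompact C := by
      refine (isCompact_Icc.prod isCompact_Icc).inter_right ?_
      have hp : Continuous (fun p : ℝ × ℝ => p.1 + p.2) := by fun_prop
      exact (isClosed_le continuous_const hp).inter (isClosed_le hp continuous_const)
    have hmem : ∀ t, 1 ≤ t → (x t, y t) ∈ C := by
      intro t ht
      refine ⟨⟨⟨(px t).le, by linarith [qx t]⟩, ⟨(py t).le, by linarith [qy t]⟩⟩, ?_,
        hcon t (by linarith)⟩
      rcases ht.eq_or_lt with h | h
      · rw [← h]
      · exact (hdec 1 t zero_le_one h).le
    obtain ⟨p, hpC, hpmin⟩ := hC.exists_isMinOn ⟨_, hmem 1 le_rfl⟩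
      (f := fun p : ℝ × ℝ => p.1 * (1 - p.1) * (k01 - k00 + (k11 + k00 - k01 - k10) * p.2)
        + p.2 * (1 - p.2) * (k10 - k00 + (k11 + k00 - k01 - k10) * p.1))
      (Continuous.continuousOn (by fun_prop))
    obtain ⟨⟨⟨a1, a2⟩, ⟨a3, a4⟩⟩, a5, a6⟩ := hpC
    have hc := hG p.1 p.2 (by linarith) a2 (by linarith) a4 (by linarith) (by linarith)
    set c := p.1 * (1 - p.1) * (k01 - k00 + (k11 + k00 - k01 - k10) * p.2)
        + p.2 * (1 - p.2) * (k10 - k00 + (k11 + k00 - k01 - k10) * p.1) with hcdef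
    have hgrow : ∀ t, 1 ≤ t → c * (t - 1) ≤ (x t + y t) - (x 1 + y 1) := by
      intro t ht
      refine (convex_Ici (1:ℝ)).mul_sub_le_image_sub_of_le_deriv (f := fun t => x t + y t)
        hSc.continuousOn (fun t _ => (hS t).differentiableAt.differentiableWithinAt) ?_
        1 Set.self_mem_Ici t ht ht
      intro s hs
      rw [interior_Ici] at hs
      rw [(hS s).deriv]
      exact hpmin (hmem s (le_of_lt hs))
    have h1c : 0 ≤ 1 / c := by positivity
    have := hgrow (1 + 1 / c) (by linarith)
    have e : c * (1 + 1 / c - 1) = 1 := by field_simp; ring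
    rw [e] at this
    linarith [qx (1 + 1 / c), qy (1 + 1 / c)]
  have ev : ∀ ε > 0, ∀ᶠ t in Filter.atTop, 2 - ε < x t + y t := by
    intro ε hε
    obtain ⟨T, hT, h⟩ := key ε hε
    filter_upwards [Filter.eventually_gt_atTop T] with t ht
    exact h.trans (hdec T t hT ht)
  refine Filter.Tendsto.prodMk_nhds ?_ ?_
  · rw [Metric.tendsto_nhds]
    intro ε hε
    filter_upwards [ev ε hε] with t ht
    rw [Real.dist_eq, abs_lt]
    constructor <;> linarith [qx t, qy t]
  · rw [Metric.tendsto_nhds]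
    intro ε hε
    filter_upwards [ev ε hε] with t ht
    rw [Real.dist_eq, abs_lt]
    constructor <;> linarith [qx t, qy t]
end
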